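/- arXiv:2402.12340 — 3 statements merged into one kernel-verified Lean document; each statement's English description precedes it below -/
import Mathlib

section
/- Let n, m ≥ 1 be natural numbers and let f be a uniformly random function from Fin n to Fin m, i.e., f is distributed according to the product over i ∈ Fin n of the uniform probability measure on Fin m. Then for any fixed index i ∈ Fin n, the expectation of 1 / |{k : f k = f i}| (the reciprocal of the size of the fiber of f containing i) equals (m/n) · (1 - (1 - 1/m)^n). -/
open MeasureTheory

open Finset in
theorem sum_one_div_card_fiber_eq_card_image {ι α : Type*} [Fintype ι] [DecidableEq α]
    (f : ι → α) :
    ∑ i, (1 / (#{k | f k = f i} : ℝ)) = #(univ.image f) := by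
  rw [sum_comp (fun x => 1 / (#{k | f k = x} : ℝ)) f, card_eq_sum_ones, Nat.cast_sum]
  refine sum_congr rfl fun x hx => ?_
  obtain ⟨i, -, rfl⟩ := mem_image.1 hx
  have : (#{k | f k = f i} : ℝ) ≠ 0 :=
    Nat.cast_ne_zero.2 (card_ne_zero_of_mem (a := i) (by simp))
  simp [this]

open Finset in
theorem card_filter_mem_image_univ {ι α : Type*} [Fintype ι] [DecidableEq ι] [Fintype α]
    [DecidableEq α] (x : α) :
    (#{f : ι → α | x ∈ univ.image f} : ℝ) =
      (Fintype.card α : ℝ) ^ Fintype.card ι - ((Fintype.card α : ℝ) - 1) ^ Fintype.card ι := by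
  have hcompl : #{f : ι → α | x ∉ univ.image f} = (Fintype.card α - 1) ^ Fintype.card ι := by
    have : ({f : ι → α | x ∉ univ.image f} : Finset (ι → α)) =
        Fintype.piFinset fun _ => univ.erase x := by
      ext f; simp
    rw [this, Fintype.card_piFinset, prod_const, card_erase_of_mem (mem_univ x), card_univ,
      card_univ]
  have htotal := card_filter_add_card_filter_not (s := (univ : Finset (ι → α)))
    (fun f => x ∈ univ.image f)
  rw [hcompl, card_univ, Fintype.card_fun] at htotal
  have hpos : 1 ≤ Fintype.card α := Fintype.card_pos_iff.2 ⟨x⟩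
  rw [eq_sub_iff_add_eq]
  exact_mod_cast htotal

open Finset in
theorem sum_card_image_univ {ι α : Type*} [Fintype ι] [DecidableEq ι] [Fintype α]
    [DecidableEq α] :
    ∑ f : ι → α, (#(univ.image f) : ℝ) = Fintype.card α *
      ((Fintype.card α : ℝ) ^ Fintype.card ι -
        ((Fintype.card α : ℝ) - 1) ^ Fintype.card ι) := by
  have h := sum_card_bipartiteAbove_eq_sum_card_bipartiteBelow (s := (univ : Finset (ι → α)))
    (t := (univ : Finset α)) (fun f x => x ∈ univ.image f)
  simp only [bipartiteAbove, bipartiteBelow, filter_univ_mem] at h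
  rw [← Nat.cast_sum, h, Nat.cast_sum]
  simp_rw [card_filter_mem_image_univ, sum_const, card_univ, nsmul_eq_mul]

open Finset in
theorem sum_one_div_card_fiber_eq {ι α : Type*} [Fintype ι] [DecidableEq ι] [Fintype α]
    [DecidableEq α] (i j : ι) :
    ∑ f : ι → α, (1 / (#{k | f k = f i} : ℝ)) = ∑ f : ι → α, (1 / (#{k | f k = f j} : ℝ)) := by
  refine Fintype.sum_equiv ((Equiv.swap i j).arrowCongr (Equiv.refl α)) _ _ fun f => ?_
  congr 2
  exact card_equiv (Equiv.swap i j) (by simp)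

open Finset in
theorem card_mul_sum_one_div_card_fiber {ι α : Type*} [Fintype ι] [DecidableEq ι] [Fintype α]
    [DecidableEq α] (i : ι) :
    Fintype.card ι * ∑ f : ι → α, (1 / (#{k | f k = f i} : ℝ)) = Fintype.card α *
      ((Fintype.card α : ℝ) ^ Fintype.card ι -
        ((Fintype.card α : ℝ) - 1) ^ Fintype.card ι) := by
  rw [← sum_card_image_univ]
  simp_rw [← sum_one_div_card_fiber_eq_card_image]
  rw [sum_comm, sum_congr rfl fun j _ => sum_one_div_card_fiber_eq j i]
  simp

/-- Let `f` be a uniformly random function from `Fin n` to `Fin m` (each of the `n` agents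
independently picks a uniformly random element of `Fin m`; the uniform probability measure `ν`
on `Fin m` is characterized by giving each singleton mass `1/m`).  For any fixed `i : Fin n`,
the expectation of the reciprocal of the size of the fiber of `f` containing `i` equals
`(m/n) · (1 - (1 - 1/m)^n)`. -/
theorem expected_inv_fiber_size (n m : ℕ) (hn : 1 ≤ n) (hm : 1 ≤ m)
    (ν : Measure (Fin m)) [IsProbabilityMeasure ν]
    (hν : ∀ x : Fin m, ν {x} = (m : ENNReal)⁻¹) (i : Fin n) :
    ∫ f : Fin n → Fin m,
        (1 / ((Finset.univ.filter fun k : Fin n => f k = f i).card : ℝ))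
        ∂(Measure.pi fun _ : Fin n => ν)
      = ((m : ℝ) / (n : ℝ)) * (1 - (1 - 1 / (m : ℝ)) ^ n) := by
  have hn' : (n : ℝ) ≠ 0 := by positivity
  have hm' : (m : ℝ) ≠ 0 := by positivity
  have hsum := card_mul_sum_one_div_card_fiber (α := Fin m) i
  simp only [Fintype.card_fin] at hsum
  have hmass (f : Fin n → Fin m) :
      (Measure.pi fun _ : Fin n => ν).real {f} = ((m : ℝ) ^ n)⁻¹ := by
    simp [measureReal_def, Measure.pi_singleton, hν]
  have hpow : (1 - 1 / (m : ℝ)) ^ n = ((m : ℝ) - 1) ^ n / (m : ℝ) ^ n := by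
    rw [← div_pow, sub_div, div_self hm']
  rw [integral_fintype .of_finite]
  simp only [hmass, smul_eq_mul]
  rw [← Finset.mul_sum, hpow, eq_div_of_mul_eq hn' ((mul_comm _ _).trans hsum)]
  field_simp
end

section
/- For all natural numbers n, m with m ≥ n ≥ 1, the real number (m/n) · (1 - (1 - 1/m)^n) is at least 1 - 1/e, where e = Real.exp 1. -/
/-- On `[0, 1]`, `exp (-x)` lies below its chord. -/
theorem Real.exp_neg_le_chord {x : ℝ} (h0 : 0 ≤ x) (h1 : x ≤ 1) :
    Real.exp (-x) ≤ 1 - x * (1 - 1 / Real.exp 1) := by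
  have h := convexOn_exp.2 (Set.mem_univ 0) (Set.mem_univ (-1)) (sub_nonneg.2 h1) h0 (by ring)
  simp only [smul_eq_mul, mul_zero, zero_add, mul_neg, mul_one, Real.exp_zero,
    Real.exp_neg 1] at h
  rw [one_div]
  linarith

/-- For all natural numbers `n, m` with `m ≥ n ≥ 1`, the real number
`(m/n) · (1 - (1 - 1/m)^n)` is at least `1 - 1/e`, where `e = Real.exp 1`. -/
theorem alloc_prob_ge_one_sub_inv_exp (n m : ℕ) (hn : 1 ≤ n) (hnm : n ≤ m) :
    1 - 1 / Real.exp 1 ≤ ((m : ℝ) / (n : ℝ)) * (1 - (1 - 1 / (m : ℝ)) ^ n) := by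
  have hn0 : (0 : ℝ) < n := by exact_mod_cast hn
  have hm1 : (1 : ℝ) ≤ m := by exact_mod_cast hn.trans hnm
  have hm0 : (0 : ℝ) < m := by linarith
  have hx1 : (n : ℝ) / m ≤ 1 := (div_le_one hm0).2 (by exact_mod_cast hnm)
  have hpow : (1 - 1 / (m : ℝ)) ^ n ≤ Real.exp (-((n : ℝ) / m)) := by
    calc (1 - 1 / (m : ℝ)) ^ n ≤ Real.exp (-(1 / (m : ℝ))) ^ n :=
          pow_le_pow_left₀ (sub_nonneg.2 ((div_le_one hm0).2 hm1))
            (Real.one_sub_le_exp_neg _) n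
      _ = Real.exp (-((n : ℝ) / m)) := by
          rw [← Real.exp_nat_mul]
          congr 1
          ring
  have hchord := Real.exp_neg_le_chord (div_nonneg hn0.le hm0.le) hx1
  calc 1 - 1 / Real.exp 1
      = ((m : ℝ) / n) * (((n : ℝ) / m) * (1 - 1 / Real.exp 1)) := by field_simp
    _ ≤ ((m : ℝ) / n) * (1 - (1 - 1 / (m : ℝ)) ^ n) :=
        mul_le_mul_of_nonneg_left (by linarith) (by positivity)
end

section
/- For every natural number n ≥ 1, the function sending a natural number m ≥ 1 to the real number (m/n) · (1 - (1 - 1/m)^n) is monotone nondecreasing in m: for all natural numbers m, m' with 1 ≤ m ≤ m', we have (m/n) · (1 - (1 - 1/m)^n) ≤ (m'/n) · (1 - (1 - 1/m')^n). -/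
theorem mul_one_sub_one_sub_one_div_pow {K : Type*} [Field K] {x : K} (hx : x ≠ 0) (n : ℕ) :
    x * (1 - (1 - 1 / x) ^ n) = ∑ i ∈ Finset.range n, (1 - 1 / x) ^ i := by
  rw [← mul_neg_geom_sum, sub_sub_cancel, ← mul_assoc, mul_one_div_cancel hx, one_mul]

/-- For every natural number `n ≥ 1`, the function sending a natural number `m ≥ 1` to the
real number `(m/n) · (1 - (1 - 1/m)^n)` is monotone nondecreasing in `m`. -/
theorem alloc_prob_monotone_in_items (n : ℕ) (hn : 1 ≤ n) :
    ∀ m m' : ℕ, 1 ≤ m → m ≤ m' →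
      ((m : ℝ) / (n : ℝ)) * (1 - (1 - 1 / (m : ℝ)) ^ n) ≤
        ((m' : ℝ) / (n : ℝ)) * (1 - (1 - 1 / (m' : ℝ)) ^ n) := by
  intro m m' hm hmm'
  have hm1 : (1 : ℝ) ≤ m := by exact_mod_cast hm
  have hle : (m : ℝ) ≤ m' := by exact_mod_cast hmm'
  have hpos : (0 : ℝ) < m := by linarith
  have hbase : 0 ≤ 1 - 1 / (m : ℝ) := sub_nonneg.2 ((div_le_one hpos).2 hm1)
  rw [div_mul_eq_mul_div, div_mul_eq_mul_div, mul_one_sub_one_sub_one_div_pow hpos.ne',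
    mul_one_sub_one_sub_one_div_pow (hpos.trans_le hle).ne']
  gcongr
end
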